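/- arXiv:2002.04191 — 2 statements merged into one kernel-verified Lean document; each statement's English description precedes it below -/
import Mathlib

section
/- For every positive integer n, the coefficients of the binary form S_n(X,Y) = 2^(n−1−ν₂(n)) · F_n*(X,Y) are integers whose greatest common divisor is 1; explicitly, S_n(X,Y) = 2^(−ν₂(n)) · ∑_{1 ≤ k ≤ n, k odd} (−1)^((k−1)/2) · C(n,k) · X^(n−k) · Y^k, each number 2^(−ν₂(n))·C(n,k) for odd k is an integer, and the gcd of these integers over all odd k with 1 ≤ k ≤ n equals 1. -/
open Real Finset

theorem IsPrimitiveRoot.prod_Icc_sub_pow_mul {K : Type*} [Field K] {ζ : K} {n : ℕ}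
    (h : IsPrimitiveRoot ζ n) (hn : 0 < n) (x y : K) :
    ∏ k ∈ Icc 1 n, (x - ζ ^ k * y) = x ^ n - y ^ n := by
  have h1 : ∏ k ∈ Icc 1 n, (x - ζ ^ k * y) = ∏ k ∈ range n, (x - ζ ^ k * y) := by
    obtain ⟨m, rfl⟩ : ∃ m, n = m + 1 := ⟨n - 1, by omega⟩
    rw [← Finset.Ico_add_one_right_eq_Icc, Finset.prod_Ico_eq_prod_range]
    simp only [Nat.add_sub_cancel]
    rw [prod_range_succ, prod_range_succ', Nat.add_comm 1 m, h.pow_eq_one]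
    simp only [pow_zero, Nat.add_comm 1]
  rw [h1, h.pow_sub_pow_eq_prod_sub_mul x y hn]
  refine prod_nbij (fun k => ζ ^ k) (fun k _ => ?_) (fun i hi j hj hij => ?_) (fun μ hμ => ?_)
    (fun _ _ => rfl)
  · rw [Polynomial.mem_nthRootsFinset hn, pow_right_comm, h.pow_eq_one, one_pow]
  · exact h.pow_inj (by simpa using hi) (by simpa using hj) hij
  · have : NeZero n := ⟨hn.ne'⟩
    rw [mem_coe, Polynomial.mem_nthRootsFinset hn] at hμ
    obtain ⟨i, hi, rfl⟩ := h.eq_pow_of_pow_eq_one hμ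
    exact ⟨i, by simpa using hi, rfl⟩

theorem Complex.ofReal_mul_sin_sub_mul_cos (x y θ : ℝ) :
    ((x * Real.sin θ - y * Real.cos θ : ℝ) : ℂ) =
      I / 2 * exp (-(θ * I)) * ((x + y * I) - exp (2 * (θ * I)) * (x - y * I)) := by
  have h2 : exp (2 * (θ * I)) = exp (θ * I) * exp (θ * I) := by rw [← exp_add, two_mul]
  have h3 : exp (-(θ * I)) * exp (θ * I) = 1 := by rw [← exp_add]; simp
  have h4 : exp (-(θ * I)) = cos θ - sin θ * I := by
    rw [← neg_mul, exp_mul_I, cos_neg, sin_neg]; ring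
  have h5 : I / 2 * exp (-(θ * I)) * ((x + y * I) - exp (2 * (θ * I)) * (x - y * I)) =
      I / 2 * (exp (-(θ * I)) * (x + y * I) - exp (θ * I) * (x - y * I)) := by
    rw [h2]
    linear_combination (-(I / 2) * exp (θ * I) * (x - y * I)) * h3
  rw [h5, h4, exp_mul_I]
  push_cast
  linear_combination (x * sin θ - y * cos θ : ℂ) * I_sq

theorem Complex.prod_exp_neg_mul_pi_div (n : ℕ) (hn : 0 < n) :
    ∏ k ∈ Icc 1 n, exp (-(((k * π / n : ℝ) : ℂ) * I)) = (-I) ^ (n + 1) := by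
  have hn' : (n : ℂ) ≠ 0 := by exact_mod_cast hn.ne'
  have hsum : ∀ m : ℕ, ∑ k ∈ Icc 1 m, (k : ℂ) = m * (m + 1) / 2 := by
    intro m
    induction m with
    | zero => simp
    | succ m ih => rw [sum_Icc_succ_top (by omega), ih]; push_cast; ring
  have hI : exp (-(π / 2 * I)) = -I := by
    rw [exp_neg, exp_pi_div_two_mul_I, inv_I]
  rw [← exp_sum, ← hI, ← exp_nat_mul]
  congr 1
  have : ∀ k : ℕ, -(((k * π / n : ℝ) : ℂ) * I) = k * (-(π / n * I)) := by
    intro k; push_cast; ring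
  simp only [this]
  rw [← sum_mul, hsum]
  push_cast
  field_simp

theorem Complex.sub_conj_pow (x y : ℝ) (n : ℕ) :
    (x + y * I : ℂ) ^ n - (x - y * I) ^ n = 2 * ((((x + y * I : ℂ) ^ n).im : ℝ) : ℂ) * I := by
  have h : (x - y * I : ℂ) ^ n = (starRingEnd ℂ) ((x + y * I : ℂ) ^ n) := by
    simp [sub_eq_add_neg]
  rw [h, sub_conj]
  push_cast
  ring

theorem two_pow_mul_prod_sin_sub_cos (n : ℕ) (hn : 0 < n) (x y : ℝ) :
    (2 : ℝ) ^ (n - 1) * ∏ k ∈ Icc 1 n, (x * Real.sin (k * π / n) - y * Real.cos (k * π / n)) =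
      ((x + y * Complex.I : ℂ) ^ n).im := by
  have hn' : (n : ℂ) ≠ 0 := by exact_mod_cast hn.ne'
  have hζ := Complex.isPrimitiveRoot_exp n hn.ne'
  have hpow : ∀ k : ℕ, Complex.exp (2 * (((k * π / n : ℝ) : ℂ) * Complex.I)) =
      Complex.exp (2 * π * Complex.I / n) ^ k := by
    intro k
    rw [← Complex.exp_nat_mul]
    congr 1
    push_cast
    ring
  apply Complex.ofReal_injective
  rw [Complex.ofReal_mul, Complex.ofReal_prod]
  simp only [Complex.ofReal_mul_sin_sub_mul_cos, hpow]
  rw [prod_mul_distrib, prod_mul_distrib, hζ.prod_Icc_sub_pow_mul hn,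
    Complex.prod_exp_neg_mul_pi_div n hn, Complex.sub_conj_pow, prod_const, Nat.card_Icc,
    Nat.add_sub_cancel]
  obtain ⟨m, rfl⟩ : ∃ m, n = m + 1 := ⟨n - 1, by omega⟩
  have h1 : (Complex.I / 2) ^ (m + 1) * (-Complex.I) ^ (m + 1 + 1) =
      (1 / 2) ^ (m + 1) * (-Complex.I) := by
    rw [pow_succ (-Complex.I), ← mul_assoc, ← mul_pow]
    congr 2
    linear_combination (-1 / 2 : ℂ) * Complex.I_sq
  have h2 : (2 : ℂ) ^ m * (1 / 2) ^ m = 1 := by rw [← mul_pow]; norm_num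
  rw [h1, Nat.add_sub_cancel, pow_succ (1 / 2 : ℂ)]
  push_cast
  generalize ((((x + y * Complex.I : ℂ) ^ (m + 1)).im : ℝ) : ℂ) = w
  linear_combination (-w * Complex.I ^ 2) * h2 - w * Complex.I_sq

theorem Complex.im_add_mul_I_pow (n : ℕ) (x y : ℝ) :
    ((x + y * I : ℂ) ^ n).im =
      ∑ k ∈ (Icc 1 n).filter (fun k => Odd k),
        (-1 : ℝ) ^ ((k - 1) / 2) * (n.choose k : ℝ) * x ^ (n - k) * y ^ k := by
  have hterm : ∀ k : ℕ, ((y * I : ℂ) ^ k * (x : ℂ) ^ (n - k) * (n.choose k : ℂ)).im =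
      if Odd k then (-1 : ℝ) ^ ((k - 1) / 2) * (n.choose k : ℝ) * x ^ (n - k) * y ^ k else 0 := by
    intro k
    have hre : (y * I : ℂ) ^ k * (x : ℂ) ^ (n - k) * (n.choose k : ℂ) =
        ((n.choose k * x ^ (n - k) * y ^ k : ℝ) : ℂ) * I ^ k := by
      push_cast; ring
    rw [hre, im_ofReal_mul]
    rcases Nat.even_or_odd' k with ⟨j, rfl | rfl⟩
    · have : (I ^ (2 * j)) = (((-1) ^ j : ℝ) : ℂ) := by rw [pow_mul, I_sq]; push_cast; rfl
      rw [this, ofReal_im, if_neg (by simp), mul_zero]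
    · have : (I ^ (2 * j + 1)) = (((-1) ^ j : ℝ) : ℂ) * I := by
        rw [pow_succ, pow_mul, I_sq]; push_cast; rfl
      rw [this, im_ofReal_mul, I_im, if_pos (by simp)]
      have hj : (2 * j + 1 - 1) / 2 = j := by omega
      rw [hj]
      ring
  rw [add_comm (x : ℂ), add_pow, im_sum]
  simp only [hterm]
  rw [← sum_filter]
  refine sum_congr ?_ fun _ _ => rfl
  ext k
  simp only [mem_filter, mem_range, mem_Icc]
  constructor
  · rintro ⟨h1, h2⟩; exact ⟨⟨h2.pos, by omega⟩, h2⟩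
  · rintro ⟨h1, h2⟩; exact ⟨by omega, h2⟩

theorem Nat.two_pow_padicValNat_dvd_choose {n k : ℕ} (hk : Odd k) :
    2 ^ padicValNat 2 n ∣ n.choose k := by
  obtain ⟨j, rfl⟩ : ∃ j, k = j + 1 := ⟨k - 1, by have := hk.pos; omega⟩
  rcases n with _ | m
  · simp
  have h : 2 ^ padicValNat 2 (m + 1) ∣ (m + 1).choose (j + 1) * (j + 1) := by
    rw [← Nat.add_one_mul_choose_eq]
    exact pow_padicValNat_dvd.mul_right _
  exact (Nat.Coprime.pow_left _ (Nat.coprime_two_left.2 hk)).dvd_of_dvd_mul_right h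

theorem Nat.two_mul_sum_odd_choose {n : ℕ} (hn : 0 < n) :
    2 * ∑ k ∈ (Icc 1 n).filter (fun k => Odd k), n.choose k = 2 ^ n := by
  have hset : (Icc 1 n).filter (fun k => Odd k) = (range (n + 1)).filter (fun k => Odd k) := by
    ext k
    simp only [mem_filter, mem_range, mem_Icc]
    constructor
    · rintro ⟨h1, h2⟩; exact ⟨by omega, h2⟩
    · rintro ⟨h1, h2⟩; exact ⟨⟨h2.pos, by omega⟩, h2⟩
  have h1 : ∑ k ∈ range (n + 1), (n.choose k : ℤ) = 2 ^ n := by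
    exact_mod_cast Nat.sum_range_choose n
  have h2 := Int.alternating_sum_range_choose_of_ne hn.ne'
  have h3 : ∑ k ∈ range (n + 1), ((n.choose k : ℤ) - (-1) ^ k * n.choose k) = 2 ^ n := by
    rw [sum_sub_distrib, h1, h2, sub_zero]
  zify
  rw [hset, sum_filter, ← h3, mul_sum]
  refine sum_congr rfl fun k _ => ?_
  split_ifs with hk
  · rw [hk.neg_one_pow]; ring
  · rw [(Nat.not_odd_iff_even.1 hk).neg_one_pow]; ring

theorem Sn_integer_coeffs_gcd_one (n : ℕ) (hn : 0 < n) :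
    (∀ x y : ℝ,
        (2 : ℝ) ^ (n - 1 - padicValNat 2 n) *
            ∏ k ∈ Finset.Icc 1 n, (x * Real.sin (k * π / n) - y * Real.cos (k * π / n)) =
          ∑ k ∈ (Finset.Icc 1 n).filter (fun k => Odd k),
            (-1 : ℝ) ^ ((k - 1) / 2) * ((n.choose k / 2 ^ padicValNat 2 n : ℕ) : ℝ) *
              x ^ (n - k) * y ^ k) ∧
      (∀ k ∈ (Finset.Icc 1 n).filter (fun k => Odd k),
        2 ^ padicValNat 2 n ∣ n.choose k) ∧
      ((Finset.Icc 1 n).filter (fun k => Odd k)).gcd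
          (fun k => n.choose k / 2 ^ padicValNat 2 n) = 1 := by
  have hdvd : ∀ k ∈ (Finset.Icc 1 n).filter (fun k => Odd k),
      2 ^ padicValNat 2 n ∣ n.choose k :=
    fun k hk => Nat.two_pow_padicValNat_dvd_choose (mem_filter.1 hk).2
  refine ⟨fun x y => ?_, hdvd, ?_⟩
  · have hv : padicValNat 2 n ≤ n - 1 := by
      have h1 : 2 ^ padicValNat 2 n ≤ n := Nat.le_of_dvd hn pow_padicValNat_dvd
      have h2 : padicValNat 2 n < 2 ^ padicValNat 2 n := Nat.lt_two_pow_self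
      omega
    have h2 : (2 : ℝ) ^ padicValNat 2 n ≠ 0 := by positivity
    apply mul_left_cancel₀ h2
    rw [← mul_assoc, ← pow_add, Nat.add_sub_cancel' hv, two_pow_mul_prod_sin_sub_cos n hn,
      Complex.im_add_mul_I_pow, mul_sum]
    refine sum_congr rfl fun k hk => ?_
    rw [Nat.cast_div (hdvd k hk) (by exact_mod_cast h2)]
    push_cast
    field_simp
  · set g := ((Finset.Icc 1 n).filter (fun k => Odd k)).gcd
      (fun k => n.choose k / 2 ^ padicValNat 2 n) with hg
    have hgdvd : ∀ k ∈ (Finset.Icc 1 n).filter (fun k => Odd k),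
        g ∣ n.choose k / 2 ^ padicValNat 2 n := fun k hk => gcd_dvd hk
    have hcop : Nat.Coprime 2 (n / 2 ^ padicValNat 2 n) := by
      rw [← Nat.factorization_def n Nat.prime_two]
      exact Nat.coprime_ordCompl Nat.prime_two hn.ne'
    have hg1 : g ∣ n / 2 ^ padicValNat 2 n := by
      simpa using hgdvd 1 (by simp; omega)
    have hg2 : g ∣ 2 ^ n := by
      rw [← Nat.two_mul_sum_odd_choose hn]
      exact (dvd_sum fun k hk => (hgdvd k hk).trans (Nat.div_dvd_of_dvd (hdvd k hk))).mul_left 2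
    exact Nat.eq_one_of_dvd_coprimes (hcop.pow_left n) hg2 hg1
end

section
/- For every integer n ≥ 3, the area of the region { (x,y) ∈ ℝ² : |S_n(x,y)| ≤ 1 } equals 4^(ν₂(n)/n) · B(1/2 − 1/n, 1/2), where S_n(X,Y) = 2^(n−1−ν₂(n)) · F_n*(X,Y) and B is the Euler beta function. -/
open Real Finset MeasureTheory

lemma norm_exp_sub_exp (x y : ℝ) :
    ‖Complex.exp (Complex.I * x) - Complex.exp (Complex.I * y)‖ = 2 * |sin ((x - y) / 2)| := by
  have h : Complex.exp (Complex.I * x) - Complex.exp (Complex.I * y) =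
      Complex.exp (Complex.I * y) * (Complex.exp (Complex.I * (x - y : ℝ)) - 1) := by
    rw [mul_sub, ← Complex.exp_add]
    push_cast
    ring_nf
  rw [h, norm_mul, Complex.norm_exp_I_mul_ofReal_sub_one, Complex.norm_exp_I_mul_ofReal]
  simp

lemma abs_prod_sin (n : ℕ) (hn : 0 < n) (t : ℝ) :
    2 ^ (n - 1) * |∏ k ∈ Icc 1 n, sin (k * π / n - t)| = |sin (n * t)| := by
  have hn' : (n : ℝ) ≠ 0 := by positivity
  have hnC : (n : ℂ) ≠ 0 := by exact_mod_cast hn.ne'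
  have hζ := Complex.isPrimitiveRoot_exp n hn.ne'
  have key := congrArg (Polynomial.eval (Complex.exp (Complex.I * (2 * t : ℝ))))
    (X_pow_sub_C_eq_prod hζ hn hζ.pow_eq_one)
  simp only [Polynomial.eval_sub, Polynomial.eval_pow, Polynomial.eval_X, Polynomial.eval_C,
    Polynomial.eval_prod, ← pow_succ] at key
  have hlhs : Complex.exp (Complex.I * (2 * t : ℝ)) ^ n - 1 =
      Complex.exp (Complex.I * (2 * (n * t) : ℝ)) - Complex.exp (Complex.I * (0 : ℝ)) := by
    rw [← Complex.exp_nat_mul]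
    push_cast
    simp only [mul_zero, Complex.exp_zero]
    ring_nf
  have hrhs (k : ℕ) : Complex.exp (2 * π * Complex.I / n) ^ (k + 1) =
      Complex.exp (Complex.I * (2 * ((k + 1 : ℕ) * π / n) : ℝ)) := by
    rw [← Complex.exp_nat_mul]
    push_cast
    ring_nf
  rw [hlhs] at key
  simp only [hrhs] at key
  have key := congrArg norm key
  rw [norm_prod, norm_exp_sub_exp] at key
  simp only [norm_exp_sub_exp] at key
  rw [prod_mul_distrib, prod_const, card_range] at key
  have hre : |∏ k ∈ Icc 1 n, sin (k * π / n - t)| =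
      ∏ i ∈ range n, |sin ((2 * t - 2 * ((i + 1 : ℕ) * π / n)) / 2)| := by
    rw [abs_prod, range_eq_Ico,
      prod_Ico_add' (fun k : ℕ ↦ |sin ((2 * t - 2 * (k * π / n)) / 2)|) 0 n 1]
    refine prod_congr (by ext; simp) fun k _ ↦ ?_
    rw [← abs_neg, ← sin_neg]
    ring_nf
  rw [hre]
  have h2 : (2 : ℝ) ^ n = 2 * 2 ^ (n - 1) := by
    rw [← pow_succ']
    congr
    omega
  rw [h2] at key
  have h3 : (2 * (n * t) - 0) / 2 = n * t := by ring
  rw [h3] at key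
  linarith

lemma integral_abs_sin_rpow {s : ℝ} (hs : -1 < s) :
    Gamma ((s + 1) / 2) * Gamma (1 / 2) =
      Gamma (s / 2 + 1) / 2 * ∫ t in -π..π, |sin t| ^ s := by
  have habs {q : ℝ} (hq : -1 < q) :
      ∫ x : ℝ, |x| ^ q * exp (-x ^ 2) = Gamma ((q + 1) / 2) := by
    have h := integral_comp_abs (f := fun x ↦ x ^ q * exp (-x ^ (2 : ℝ)))
    rw [integral_rpow_mul_exp_neg_rpow two_pos hq] at h
    simp only [rpow_two, sq_abs] at h
    rw [h]
    ring
  have hplane : ∫ p : ℝ × ℝ, (|p.1| ^ (0 : ℝ) * exp (-p.1 ^ 2)) * (|p.2| ^ s * exp (-p.2 ^ 2)) =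
      Gamma ((s + 1) / 2) * Gamma (1 / 2) := by
    rw [Measure.volume_eq_prod, integral_prod_mul (fun x : ℝ ↦ |x| ^ (0 : ℝ) * exp (-x ^ 2))
      (fun y : ℝ ↦ |y| ^ s * exp (-y ^ 2)), habs hs, habs (by norm_num)]
    rw [zero_add, mul_comm]
  rw [← hplane, ← integral_comp_polarCoord_symm]
  have hpt : ∀ p ∈ polarCoord.target,
      p.1 • ((|(polarCoord.symm p).1| ^ (0 : ℝ) * exp (-(polarCoord.symm p).1 ^ 2)) *
        (|(polarCoord.symm p).2| ^ s * exp (-(polarCoord.symm p).2 ^ 2))) =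
      (p.1 ^ (s + 1) * exp (-p.1 ^ (2 : ℝ))) * |sin p.2| ^ s := by
    rintro ⟨r, t⟩ ⟨hr, -⟩
    simp only [Set.mem_Ioi] at hr
    simp only [polarCoord_symm_apply, rpow_zero, one_mul, smul_eq_mul, abs_mul, abs_of_pos hr]
    rw [mul_rpow hr.le (abs_nonneg _), rpow_add_one hr.ne', rpow_two]
    have : exp (-r ^ 2) = exp (-(r * cos t) ^ 2) * exp (-(r * sin t) ^ 2) := by
      rw [← exp_add]
      congr 1
      linear_combination r ^ 2 * sin_sq_add_cos_sq t
    rw [this]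
    ring
  rw [setIntegral_congr_fun polarCoord.open_target.measurableSet hpt, polarCoord_target,
    Measure.volume_eq_prod,
    setIntegral_prod_mul (fun r : ℝ ↦ r ^ (s + 1) * exp (-r ^ (2 : ℝ))) (fun t ↦ |sin t| ^ s),
    integral_rpow_mul_exp_neg_rpow two_pos (by linarith),
    intervalIntegral.integral_of_le (by linarith [pi_pos]), integral_Ioc_eq_integral_Ioo]
  ring_nf

lemma integral_abs_sin_rpow_eq {s : ℝ} (hs : -1 < s) :
    ∫ t in -π..π, |sin t| ^ s = 2 * (Gamma ((s + 1) / 2) * Gamma (1 / 2) / Gamma (s / 2 + 1)) := by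
  have hpos : 0 < Gamma (s / 2 + 1) := Gamma_pos_of_pos (by linarith)
  rw [integral_abs_sin_rpow hs, div_mul_eq_mul_div, div_right_comm, mul_div_cancel_left₀ _ hpos.ne']
  ring

lemma integral_abs_sin_rpow_pos {s : ℝ} (hs : -1 < s) : 0 < ∫ t in -π..π, |sin t| ^ s := by
  have h1 : 0 < Gamma (s / 2 + 1) := Gamma_pos_of_pos (by linarith)
  have h2 : 0 < Gamma ((s + 1) / 2) := Gamma_pos_of_pos (by linarith)
  have h3 : 0 < Gamma (1 / 2) := Gamma_pos_of_pos (by norm_num)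
  rw [integral_abs_sin_rpow_eq hs]
  positivity

lemma integral_abs_sin_nat_mul_rpow {n : ℕ} (hn : n ≠ 0) {s : ℝ} (hs : -1 < s) :
    ∫ t in -π..π, |sin (n * t)| ^ s = ∫ t in -π..π, |sin t| ^ s := by
  have hn' : (n : ℝ) ≠ 0 := by exact_mod_cast hn
  have hper : Function.Periodic (fun t ↦ |sin t| ^ s) (2 * π) := fun t ↦ by
    simp only [sin_add_two_pi]
  have hint : IntervalIntegrable (fun t ↦ |sin t| ^ s) volume (-π) (-π + 2 * π) := by
    rw [show -π + 2 * π = π by ring, intervalIntegrable_iff_integrableOn_Ioc_of_le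
      (by linarith [pi_pos])]
    refine Integrable.of_integral_ne_zero ?_
    rw [← intervalIntegral.integral_of_le (by linarith [pi_pos])]
    exact (integral_abs_sin_rpow_pos hs).ne'
  rw [intervalIntegral.integral_comp_mul_left (fun t ↦ |sin t| ^ s) hn']
  have h := hper.intervalIntegral_add_zsmul_eq n (n * -π)
    (hper.intervalIntegrable (by positivity) hint)
  rw [hper.intervalIntegral_add_eq (n * -π) (-π)] at h
  simp only [zsmul_eq_mul, Int.cast_natCast] at h
  rw [show (n : ℝ) * -π + n * (2 * π) = n * π by ring, show -π + 2 * π = π by ring] at h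
  rw [h, smul_eq_mul, inv_mul_cancel_left₀ hn']

lemma lintegral_radial {n : ℕ} (hn : n ≠ 0) {c : ℝ} (hc : 0 < c) :
    ∫⁻ r in Set.Ioi (0 : ℝ), ENNReal.ofReal r * {r : ℝ | c * r ^ n ≤ 1}.indicator 1 r =
      ENNReal.ofReal (c ^ (-2 / n : ℝ) / 2) := by
  have hn' : (n : ℝ) ≠ 0 := by exact_mod_cast hn
  have hR : 0 < c ^ (-1 / n : ℝ) := rpow_pos_of_pos hc _
  have hRn : c * (c ^ (-1 / n : ℝ)) ^ n = 1 := by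
    rw [← rpow_natCast, ← rpow_mul hc.le, div_mul_cancel₀ _ hn', rpow_neg_one,
      mul_inv_cancel₀ hc.ne']
  have hind : ∀ r ∈ Set.Ioi (0 : ℝ),
      ENNReal.ofReal r * {r : ℝ | c * r ^ n ≤ 1}.indicator 1 r =
      (Set.Iic (c ^ (-1 / n : ℝ))).indicator (fun r ↦ ENNReal.ofReal r) r := by
    intro r hr
    have hiff : c * r ^ n ≤ 1 ↔ r ≤ c ^ (-1 / n : ℝ) := by
      nth_rw 1 [← hRn]
      rw [mul_le_mul_iff_right₀ hc, pow_le_pow_iff_left₀ (le_of_lt hr) hR.le hn]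
    by_cases h : r ≤ c ^ (-1 / n : ℝ) <;> simp [Set.indicator, hiff, h]
  rw [setLIntegral_congr_fun measurableSet_Ioi hind, setLIntegral_indicator measurableSet_Iic,
    Set.inter_comm, Set.Ioi_inter_Iic, ← ofReal_integral_eq_lintegral_ofReal,
    ← intervalIntegral.integral_of_le hR.le, integral_id, ← rpow_natCast, ← rpow_mul hc.le]
  · congr 2
    push_cast
    ring_nf
  · exact (continuous_id.integrableOn_Icc).mono_set Set.Ioc_subset_Icc_self
  · filter_upwards [ae_restrict_mem measurableSet_Ioc] with r hr using hr.1.le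

lemma ae_sin_nat_mul_ne_zero {n : ℕ} (hn : n ≠ 0) : ∀ᵐ t : ℝ, sin (n * t) ≠ 0 := by
  have hn' : (n : ℝ) ≠ 0 := by exact_mod_cast hn
  have hsub : {t : ℝ | ¬ sin (n * t) ≠ 0} ⊆ Set.range fun m : ℤ ↦ m * π / n := by
    intro t ht
    obtain ⟨m, hm⟩ := sin_eq_zero_iff.1 (not_not.1 ht)
    exact ⟨m, by simp only [hm]; field_simp⟩
  exact measure_mono_null hsub ((Set.countable_range _).measure_zero _)

lemma volume_abs_polar_le_one {n : ℕ} (hn : 3 ≤ n) {b : ℝ} (hb : 0 < b) {f : ℝ × ℝ → ℝ}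
    (hf : Measurable f)
    (hpolar : ∀ r > 0, ∀ t, f (r * cos t, r * sin t) = b * |sin (n * t)| * r ^ n) :
    volume {p | f p ≤ 1} = ENNReal.ofReal (b ^ (-2 / n : ℝ) *
      (Gamma (1 / 2 - 1 / n) * Gamma (1 / 2) / Gamma (1 / 2 - 1 / n + 1 / 2))) := by
  have hn0 : n ≠ 0 := by omega
  have hn3 : (3 : ℝ) ≤ n := by exact_mod_cast hn
  have hs : -1 < (-2 / n : ℝ) := by
    rw [lt_div_iff₀ (by linarith)]
    linarith
  have hms : MeasurableSet {p | f p ≤ 1} := measurableSet_le hf measurable_const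
  rw [← lintegral_indicator_one hms, ← lintegral_comp_polarCoord_symm, polarCoord_target,
    Measure.volume_eq_prod, setLIntegral_prod_symm]
  swap
  · exact ((measurable_fst.ennreal_ofReal).mul ((measurable_one.indicator hms).comp
      continuous_polarCoord_symm.measurable)).aemeasurable
  have hinner : ∀ᵐ t ∂(volume.restrict (Set.Ioo (-π) π)),
      ∫⁻ r in Set.Ioi (0 : ℝ), ENNReal.ofReal r •
        {p | f p ≤ 1}.indicator 1 (polarCoord.symm (r, t)) =
      ENNReal.ofReal (b ^ (-2 / n : ℝ) / 2 * |sin (n * t)| ^ (-2 / n : ℝ)) := by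
    filter_upwards [ae_restrict_of_ae (ae_sin_nat_mul_ne_zero hn0)] with t ht
    have hpos : 0 < |sin (n * t)| := abs_pos.2 ht
    rw [div_mul_eq_mul_div, ← mul_rpow hb.le hpos.le, ← lintegral_radial hn0 (mul_pos hb hpos)]
    refine setLIntegral_congr_fun measurableSet_Ioi fun r hr ↦ ?_
    simp only [smul_eq_mul, Set.indicator, polarCoord_symm_apply, Set.mem_ofPred_eq, hpolar r hr t,
      Pi.one_apply]
  rw [lintegral_congr_ae hinner, ← ofReal_integral_eq_lintegral_ofReal]
  · rw [integral_const_mul, ← integral_Ioc_eq_integral_Ioo,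
      ← intervalIntegral.integral_of_le (by linarith [pi_pos]),
      integral_abs_sin_nat_mul_rpow hn0 hs, integral_abs_sin_rpow_eq hs]
    ring_nf
  · refine Integrable.const_mul (Integrable.of_integral_ne_zero ?_) _
    rw [← integral_Ioc_eq_integral_Ioo,
      ← intervalIntegral.integral_of_le (by linarith [pi_pos]),
      integral_abs_sin_nat_mul_rpow hn0 hs]
    exact (integral_abs_sin_rpow_pos hs).ne'
  · exact ae_of_all _ fun t ↦ by positivity

theorem area_Sn (n : ℕ) (hn : 3 ≤ n) :
    MeasureTheory.volume
        {p : ℝ × ℝ |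
          |(2 : ℝ) ^ (n - 1 - padicValNat 2 n) *
              ∏ k ∈ Finset.Icc 1 n,
                (p.1 * Real.sin (k * π / n) - p.2 * Real.cos (k * π / n))| ≤ 1} =
      ENNReal.ofReal
        ((4 : ℝ) ^ ((padicValNat 2 n : ℝ) / n) *
          (Real.Gamma (1 / 2 - 1 / n) * Real.Gamma (1 / 2) /
            Real.Gamma (1 / 2 - 1 / n + 1 / 2))) := by
  have hn0 : 0 < n := by omega
  have hv : padicValNat 2 n ≤ n - 1 := by
    have h1 := Nat.le_of_dvd hn0 (pow_padicValNat_dvd (p := 2) (n := n))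
    have h2 := (padicValNat 2 n).lt_two_pow_self
    omega
  have hpow : (2 : ℝ) ^ (n - 1 - padicValNat 2 n) =
      (2 ^ padicValNat 2 n)⁻¹ * 2 ^ (n - 1) := by
    rw [pow_sub₀ _ two_ne_zero hv, mul_comm]
  have hcoef : ((2 ^ padicValNat 2 n)⁻¹ : ℝ) ^ (-2 / n : ℝ) =
      (4 : ℝ) ^ ((padicValNat 2 n : ℝ) / n) := by
    rw [show (4 : ℝ) = 2 ^ (2 : ℝ) by norm_num, ← rpow_natCast, ← rpow_neg two_pos.le,
      ← rpow_mul two_pos.le, ← rpow_mul two_pos.le]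
    ring_nf
  rw [← hcoef]
  refine volume_abs_polar_le_one hn (by positivity) (by fun_prop) fun r hr t ↦ ?_
  have hprod : ∏ k ∈ Icc 1 n, (r * cos t * sin (k * π / n) - r * sin t * cos (k * π / n)) =
      r ^ n * ∏ k ∈ Icc 1 n, sin (k * π / n - t) := by
    rw [show r ^ n = ∏ _k ∈ Icc 1 n, r by simp, ← prod_mul_distrib]
    refine prod_congr rfl fun k _ ↦ ?_
    rw [sin_sub]
    ring
  rw [hprod, hpow, ← abs_prod_sin n hn0 t, abs_mul, abs_mul (r ^ n),
    abs_of_pos (by positivity : 0 < ((2 ^ padicValNat 2 n)⁻¹ * 2 ^ (n - 1) : ℝ)),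
    abs_of_pos (by positivity : 0 < r ^ n)]
  ring
end
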